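/- arXiv:0706.1098 — 2 statements merged into one kernel-verified Lean document; each statement's English description precedes it below -/
import Mathlib

section
/- Let A = (a_{j,k})_{j,k≥1} be a summability matrix, i.e., a nonnegative matrix with a_{j,k} = 0 for k > j and ∑_{k=1}^∞ a_{j,k} = 1 for every j. If A satisfies condition (4.4), namely a_{j,k} ≥ a_{j+1,k} and a_{j,k} ≥ a_{j+1,k+1} for all j ≥ k ≥ 1, then A satisfies condition (1.2). -/
/-- Condition (1.2): `∑_{j=1}^l ∑_{k=1}^r a_{j,k} ≥ ∑_{j∈N_l} ∑_{k∈N_r} a_{j,k}` for all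
`l, r ≥ 1` and all finite index sets with `|N_l| = l`, `|N_r| = r`.
Indices are `0`-based: index `i` corresponds to the paper's index `i+1`. -/
def Cond12 (A : ℕ → ℕ → ℝ) : Prop :=
  ∀ l r : ℕ, 1 ≤ l → 1 ≤ r → ∀ Nl Nr : Finset ℕ, Nl.card = l → Nr.card = r →
    ∑ j ∈ Nl, ∑ k ∈ Nr, A j k ≤ ∑ j ∈ Finset.range l, ∑ k ∈ Finset.range r, A j k

/-- The order-preserving map `ℕ → ℕ` that closes a gap at `g`. -/
def closeGap (g n : ℕ) : ℕ := if n < g then n else n - 1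

lemma closeGap_injOn {g : ℕ} {s : Finset ℕ} (hg : g ∉ s) :
    Set.InjOn (closeGap g) (s : Set ℕ) := by
  intro a ha b hb hab
  have hag : a ≠ g := by rintro rfl; exact hg ha
  have hbg : b ≠ g := by rintro rfl; exact hg hb
  simp only [closeGap] at hab
  split_ifs at hab <;> omega

lemma Antitone.sum_le_sum_range_card {f : ℕ → ℝ} (hf : Antitone f) (s : Finset ℕ) :
    ∑ k ∈ s, f k ≤ ∑ k ∈ Finset.range s.card, f k := by
  induction s using Finset.induction_on_max with
  | empty => simp
  | insert a s ha ih =>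
    have has : a ∉ s := fun h => lt_irrefl _ (ha a h)
    have hcard : s.card ≤ a := by
      simpa using Finset.card_le_card (fun x hx => Finset.mem_range.2 (ha x hx) : s ⊆ _)
    rw [Finset.sum_insert has, Finset.card_insert_of_notMem has, Finset.sum_range_succ]
    linarith [hf hcard]

lemma antitone_sum_range_column {A : ℕ → ℕ → ℝ} (hA : ∀ j k, 0 ≤ A j k)
    (htri : ∀ j k, j < k → A j k = 0) (hdiag : ∀ j k, A (j + 1) (k + 1) ≤ A j k) (g : ℕ) :
    Antitone fun k => ∑ j ∈ Finset.range g, A j k := by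
  refine antitone_nat_of_succ_le fun k => ?_
  cases g with
  | zero => simp
  | succ m =>
    rw [Finset.sum_range_succ', Finset.sum_range_succ, htri 0 (k + 1) k.succ_pos]
    exact add_le_add (Finset.sum_le_sum fun j _ => hdiag j k) (hA m k)

lemma sum_column_le_closeGap {A : ℕ → ℕ → ℝ} (hA : ∀ j k, 0 ≤ A j k)
    (htri : ∀ j k, j < k → A j k = 0) (hcol : ∀ j k, k ≤ j → A (j + 1) k ≤ A j k)
    (hdiag : ∀ j k, A (j + 1) (k + 1) ≤ A j k) {s : Finset ℕ} {g h k : ℕ}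
    (hgs : g ∉ s) (hs : ∀ j < g, j ∈ s) (hhg : h ≤ g) (hkh : k ≠ h) :
    ∑ j ∈ s, A j k ≤ ∑ j ∈ s, A (closeGap g j) (closeGap h k) := by
  have hlow : s.filter (· < g) = Finset.range g := by
    ext j
    simp only [Finset.mem_filter, Finset.mem_range]
    exact ⟨And.right, fun hj => ⟨hs j hj, hj⟩⟩
  rw [← Finset.sum_filter_add_sum_filter_not s (· < g),
    ← Finset.sum_filter_add_sum_filter_not s (· < g) fun j => A (closeGap g j) (closeGap h k), hlow]
  refine add_le_add ?_ (Finset.sum_le_sum fun j hj => ?_)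
  · calc ∑ j ∈ Finset.range g, A j k
        ≤ ∑ j ∈ Finset.range g, A j (closeGap h k) :=
          antitone_sum_range_column hA htri hdiag g (by unfold closeGap; split_ifs <;> omega)
      _ = ∑ j ∈ Finset.range g, A (closeGap g j) (closeGap h k) :=
          Finset.sum_congr rfl fun j hj => by
            rw [closeGap.eq_def g, if_pos (Finset.mem_range.1 hj)]
  · obtain ⟨hjs, hjg⟩ := Finset.mem_filter.1 hj
    have hne : j ≠ g := by rintro rfl; exact hgs hjs
    obtain ⟨i, rfl⟩ : ∃ i, j = i + 1 := ⟨j - 1, by omega⟩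
    rw [closeGap, if_neg hjg, Nat.add_sub_cancel]
    by_cases hk : k < h
    · rw [closeGap, if_pos hk]
      exact hcol i k (by omega)
    · obtain ⟨m, rfl⟩ : ∃ m, k = m + 1 := ⟨k - 1, by omega⟩
      rw [closeGap, if_neg hk, Nat.add_sub_cancel]
      exact hdiag i m

lemma sum_closeGap_lt {s : Finset ℕ} {g j : ℕ} (hgs : g ∉ s) (hj : j ∈ s) (hgj : g < j) :
    ∑ i ∈ s.image (closeGap g), i < ∑ i ∈ s, i := by
  rw [Finset.sum_image (closeGap_injOn hgs)]
  refine Finset.sum_lt_sum (fun i _ => ?_) ⟨j, hj, ?_⟩ <;> unfold closeGap <;> split_ifs <;> omega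

lemma sum_sum_le_sum_range_sum_range {A : ℕ → ℕ → ℝ} (hA : ∀ j k, 0 ≤ A j k)
    (htri : ∀ j k, j < k → A j k = 0) (hrow : ∀ j, ∑ k ∈ Finset.range (j + 1), A j k = 1)
    (hcol : ∀ j k, k ≤ j → A (j + 1) k ≤ A j k) (hdiag : ∀ j k, A (j + 1) (k + 1) ≤ A j k)
    (s t : Finset ℕ) :
    ∑ j ∈ s, ∑ k ∈ t, A j k ≤
      ∑ j ∈ Finset.range s.card, ∑ k ∈ Finset.range t.card, A j k := by
  induction hn : ∑ i ∈ s, i using Nat.strong_induction_on generalizing s t with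
  | _ n ih =>
  subst hn
  obtain ⟨g, hgs, hs⟩ : ∃ g, g ∉ s ∧ ∀ j < g, j ∈ s :=
    have hex : ∃ g, g ∉ s := Infinite.exists_notMem_finset s
    ⟨Nat.find hex, Nat.find_spec hex, fun j hj => not_not.1 (Nat.find_min hex hj)⟩
  by_cases hmax : ∃ j ∈ s, g < j
  · obtain ⟨j, hj, hgj⟩ := hmax
    by_cases hgap : ∃ h ≤ g, h ∉ t
    · obtain ⟨h, hhg, hht⟩ := hgap
      have key := ih _ (sum_closeGap_lt hgs hj hgj) (s.image (closeGap g))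
        (t.image (closeGap h)) rfl
      rw [Finset.card_image_of_injOn (closeGap_injOn hgs),
        Finset.card_image_of_injOn (closeGap_injOn hht),
        Finset.sum_image (closeGap_injOn hgs)] at key
      simp only [Finset.sum_image (closeGap_injOn hht)] at key
      refine le_trans ?_ key
      rw [Finset.sum_comm, Finset.sum_comm (s := s)]
      exact Finset.sum_le_sum fun k hk =>
        sum_column_le_closeGap hA htri hcol hdiag hgs hs hhg (by rintro rfl; exact hht hk)
    · push Not at hgap
      have hge : g ∉ s.erase j := fun hm => hgs (Finset.mem_of_mem_erase hm)
      have hcard : (insert g (s.erase j)).card = s.card := by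
        rw [Finset.card_insert_of_notMem hge, Finset.card_erase_add_one hj]
      have hlt : ∑ i ∈ insert g (s.erase j), i < ∑ i ∈ s, i := by
        rw [Finset.sum_insert hge, ← Finset.add_sum_erase s _ hj]
        omega
      have key := ih _ hlt (insert g (s.erase j)) t rfl
      rw [hcard, Finset.sum_insert hge] at key
      have hg1 : 1 ≤ ∑ k ∈ t, A g k := by
        rw [← hrow g]
        exact Finset.sum_le_sum_of_subset_of_nonneg
          (fun k hk => hgap k (Nat.lt_succ_iff.1 (Finset.mem_range.1 hk))) fun k _ _ => hA g k
      have hj1 : ∑ k ∈ t, A j k ≤ 1 := by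
        rw [← hrow j]
        rw [← Finset.sum_inter_add_sum_sdiff t (Finset.range (j + 1)),
          Finset.sum_eq_zero (s := t \ Finset.range (j + 1)) fun k hk => htri j k (by
            have := (Finset.mem_sdiff.1 hk).2
            rw [Finset.mem_range] at this
            omega), add_zero]
        exact Finset.sum_le_sum_of_subset_of_nonneg Finset.inter_subset_right fun k _ _ => hA j k
      rw [← Finset.add_sum_erase s _ hj]
      linarith
  · push Not at hmax
    have hsg : s = Finset.range g := by
      ext j
      refine ⟨fun hj => Finset.mem_range.2 (lt_of_le_of_ne (hmax j hj) ?_),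
        fun hj => hs j (Finset.mem_range.1 hj)⟩
      rintro rfl
      exact hgs hj
    rw [hsg, Finset.card_range, Finset.sum_comm, Finset.sum_comm (s := Finset.range g)]
    exact (antitone_sum_range_column hA htri hdiag g).sum_le_sum_range_card t

/-- Corollary 4.4 (first part): a summability matrix (nonnegative, lower triangular,
with all row sums equal to `1`) satisfying condition (4.4), i.e.
`a_{j,k} ≥ max (a_{j+1,k}, a_{j+1,k+1})` for all `j ≥ k ≥ 1`, satisfies condition (1.2). -/
theorem cond12_of_summability_cond44
    (A : ℕ → ℕ → ℝ) (hA : ∀ j k, 0 ≤ A j k)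
    (htri : ∀ j k, j < k → A j k = 0)
    (hrow : ∀ j, ∑' k, A j k = 1)
    (h44 : ∀ j k, k ≤ j → A (j + 1) k ≤ A j k ∧ A (j + 1) (k + 1) ≤ A j k) :
    Cond12 A := by
  have hdiag : ∀ j k, A (j + 1) (k + 1) ≤ A j k := fun j k => by
    rcases le_or_gt k j with hkj | hkj
    · exact (h44 j k hkj).2
    · exact (htri _ _ (by omega)).trans_le (hA j k)
  have hfin : ∀ j, ∑ k ∈ Finset.range (j + 1), A j k = 1 := fun j => by
    rw [← hrow j]
    refine (tsum_eq_sum fun k hk => htri j k ?_).symm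
    rw [Finset.mem_range] at hk
    omega
  rintro l r - - Nl Nr rfl rfl
  exact sum_sum_le_sum_range_sum_range hA htri hfin (fun j k hkj => (h44 j k hkj).1) hdiag Nl Nr
end

section
/- Let w = (w_n)_{n≥1} be antitone with w_1 > 0 and w_n ≥ 0 for all n, and let 1 ≤ p < ∞. Let A = A_W^{NM} be the Nörlund mean matrix of w. Then the ℓ_p-norm of A is determined by decreasing sequences: for every nonnegative sequence x with ∑_{k=1}^∞ x_k^p < ∞ there exists a nonnegative antitone sequence y with ∑_{k=1}^∞ y_k^p = ∑_{k=1}^∞ x_k^p and ∑_{j=1}^∞ ((Ay)_j)^p ≥ ∑_{j=1}^∞ ((Ax)_j)^p; moreover the same conclusion holds with the transpose (A_W^{NM})ᵗ in place of A. -/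
open scoped ENNReal

/-- `(Ax)_j = ∑_k a_{j,k} x_k`, taken in `[0,∞]`.  Rows and columns are indexed by `ℕ`,
with index `i` corresponding to the paper's index `i+1`. -/
noncomputable def mulVec (A : ℕ → ℕ → ℝ) (x : ℕ → ℝ) (j : ℕ) : ℝ≥0∞ :=
  ∑' k, ENNReal.ofReal (A j k * x k)

/-- The Nörlund mean matrix `A_W^{NM}`: entries `w_{j-k+1} / (w_1 + ⋯ + w_j)` for `j ≥ k`
and `0` for `j < k` (in the paper's 1-based indexing; here 0-based, so the entry is
`w_{j-k} / (w_0 + ⋯ + w_j)` for `k ≤ j`). -/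
noncomputable def norlundMatrix (w : ℕ → ℝ) : ℕ → ℕ → ℝ := fun j k =>
  if k ≤ j then w (j - k) / (∑ i ∈ Finset.range (j + 1), w i) else 0

/-- The `ℓ_p`-norm of `A` is determined by decreasing sequences: for every nonnegative
`x ∈ ℓ_p` there is a nonnegative decreasing `y` with the same `ℓ_p`-sum and
`∑_j ((Ay)_j)^p ≥ ∑_j ((Ax)_j)^p`. -/
def DetByDecr (p : ℝ) (A : ℕ → ℕ → ℝ) : Prop :=
  ∀ x : ℕ → ℝ, (∀ k, 0 ≤ x k) → (∑' k, ENNReal.ofReal (x k) ^ p) < ⊤ →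
    ∃ y : ℕ → ℝ, (∀ k, 0 ≤ y k) ∧ Antitone y ∧
      (∑' k, ENNReal.ofReal (y k) ^ p) = (∑' k, ENNReal.ofReal (x k) ^ p) ∧
      (∑' j, (mulVec A x j) ^ p) ≤ (∑' j, (mulVec A y j) ^ p)

open Finset MeasureTheory

/-! ### Rectangle sums of the Nörlund matrix -/

lemma sum_le_sum_range_add_of_antitone {g : ℕ → ℝ} (hg : Antitone g) (k : ℕ) (S : Finset ℕ) :
    (∀ s ∈ S, k ≤ s) → ∑ s ∈ S, g (s - k) ≤ ∑ i ∈ range S.card, g i := by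
  induction S using Finset.induction_on_max with
  | empty => simp
  | insert a S hlt ih =>
    intro hS
    have ha : a ∉ S := fun h => lt_irrefl _ (hlt a h)
    rw [sum_insert ha, card_insert_of_notMem ha, sum_range_succ, add_comm]
    have hsub : S ⊆ Ico k a := fun s hs =>
      mem_Ico.2 ⟨hS s (mem_insert_of_mem hs), hlt s hs⟩
    have hcard := card_le_card hsub
    rw [Nat.card_Ico] at hcard
    exact add_le_add (ih fun s hs => hS s (mem_insert_of_mem hs)) (hg hcard)

lemma sum_sub_le_sum_range_add_of_antitone {g : ℕ → ℝ} (hg : Antitone g) (k j : ℕ) (hkj : k ≤ j)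
    (S : Finset ℕ) (hS : ∀ s ∈ S, s ≤ k) :
    ∑ s ∈ S, g (j - s) ≤ ∑ i ∈ range S.card, g (j - k + i) := by
  have hinj : Set.InjOn (fun s => j - s) (S : Set ℕ) := by
    intro a ha b hb hab
    have h1 := hS a ha
    have h2 := hS b hb
    simp only at hab
    omega
  have hg' : Antitone fun i => g (j - k + i) := fun a b hab => hg (by omega)
  have h := sum_le_sum_range_add_of_antitone hg' (j - k) (S.image fun s => j - s) (by
    intro s hs
    obtain ⟨a, ha, rfl⟩ := mem_image.1 hs
    have := hS a ha
    omega)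
  rw [card_image_of_injOn hinj, sum_image hinj] at h
  refine le_trans (le_of_eq (sum_congr rfl fun s hs => ?_)) h
  have := hS s hs
  congr 1
  omega

section Norlund

variable {w : ℕ → ℝ}

lemma sum_range_mono_of_nonneg (hw : ∀ n, 0 ≤ w n) :
    Monotone fun n => ∑ i ∈ range n, w i := fun _ _ hab =>
  sum_le_sum_of_subset_of_nonneg (range_mono hab) fun i _ _ => hw i

lemma sum_range_succ_pos (hw0 : 0 < w 0) (hw : ∀ n, 0 ≤ w n) (n : ℕ) :
    0 < ∑ i ∈ range (n + 1), w i :=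
  lt_of_lt_of_le hw0 (single_le_sum (f := w) (fun i _ => hw i) (mem_range.2 n.succ_pos))

lemma norlundMatrix_nonneg (hw : ∀ n, 0 ≤ w n) (j k : ℕ) : 0 ≤ norlundMatrix w j k := by
  unfold norlundMatrix
  split_ifs
  · exact div_nonneg (hw _) (sum_nonneg fun i _ => hw i)
  · exact le_rfl

lemma norlundMatrix_of_le {j k : ℕ} (h : k ≤ j) :
    norlundMatrix w j k = w (j - k) / ∑ i ∈ range (j + 1), w i := if_pos h

lemma norlundMatrix_of_lt {j k : ℕ} (h : j < k) : norlundMatrix w j k = 0 :=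
  if_neg (not_le.2 h)

lemma sum_range_norlundMatrix (hw0 : 0 < w 0) (hw : ∀ n, 0 ≤ w n) (j : ℕ) :
    ∑ k ∈ range (j + 1), norlundMatrix w j k = 1 := by
  rw [sum_congr rfl fun k hk => norlundMatrix_of_le (Nat.lt_succ_iff.1 (mem_range.1 hk)),
    ← sum_div, div_eq_one_iff_eq (sum_range_succ_pos hw0 hw j).ne']
  exact sum_range_reflect w (j + 1)

lemma sum_norlundMatrix_le_one (hw0 : 0 < w 0) (hw : ∀ n, 0 ≤ w n) (j : ℕ) (K : Finset ℕ) :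
    ∑ k ∈ K, norlundMatrix w j k ≤ 1 := by
  rw [← sum_range_norlundMatrix hw0 hw j]
  rw [sum_subset (subset_union_right (s₁ := K) (s₂ := range (j + 1))) fun k _ hk =>
    norlundMatrix_of_lt (w := w) (j := j) (k := k) (by simpa using hk)]
  exact sum_le_sum_of_subset_of_nonneg subset_union_left fun k _ _ =>
    norlundMatrix_nonneg hw j k

/-- The function `i ↦ (w_i + ⋯ + w_{i+r}) / (w_0 + ⋯ + w_{i+r})`. -/
noncomputable def tailRatio (w : ℕ → ℝ) (r i : ℕ) : ℝ :=
  (∑ l ∈ range (r + 1), w (i + l)) / ∑ l ∈ range (i + r + 1), w l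

lemma tailRatio_antitone (hw0 : 0 < w 0) (hw : ∀ n, 0 ≤ w n) (hwa : Antitone w) (r : ℕ) :
    Antitone (tailRatio w r) := fun a b hab =>
  div_le_div₀ (sum_nonneg fun i _ => hw _) (sum_le_sum fun i _ => hwa (by omega))
    (sum_range_succ_pos hw0 hw _) (sum_range_mono_of_nonneg hw (by omega))

lemma tailRatio_zero (hw0 : 0 < w 0) (hw : ∀ n, 0 ≤ w n) (r : ℕ) : tailRatio w r 0 = 1 := by
  unfold tailRatio
  simp only [zero_add]
  exact div_self (sum_range_succ_pos hw0 hw r).ne'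

lemma sum_range_norlundMatrix_eq_tailRatio (hw0 : 0 < w 0) (hw : ∀ n, 0 ≤ w n) (r i : ℕ) :
    ∑ l ∈ range (r + 1), norlundMatrix w i l = tailRatio w r (i - r) := by
  rcases le_total i r with h | h
  · rw [Nat.sub_eq_zero_of_le h, tailRatio_zero hw0 hw, ← sum_range_norlundMatrix hw0 hw i]
    refine (sum_subset (range_mono (by omega)) fun l _ hl => ?_).symm
    exact norlundMatrix_of_lt (by simpa using hl)
  · have h1 : ∀ l ∈ range (r + 1), norlundMatrix w i l =
        w (i - r + (r + 1 - 1 - l)) / ∑ l ∈ range (i - r + r + 1), w l := by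
      intro l hl
      have hl := mem_range.1 hl
      rw [norlundMatrix_of_le (by omega), show i - r + r = i by omega,
        show i - r + (r + 1 - 1 - l) = i - l by omega]
    rw [sum_congr rfl h1, ← sum_div, tailRatio]
    congr 1
    exact sum_range_reflect (fun l => w (i - r + l)) (r + 1)

/-- If at most `r` rows of `J` lie above the largest column `k` of `insert k K`, the rectangle sum
is bounded row by row. -/
lemma sum_rows_le (hw0 : 0 < w 0) (hw : ∀ n, 0 ≤ w n) (hwa : Antitone w)
    (J K : Finset ℕ) (k : ℕ) (hlt : ∀ l ∈ K, l < k) (hm : #{j ∈ J | j < k} ≤ #K) :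
    ∑ j ∈ J, ∑ l ∈ insert k K, norlundMatrix w j l ≤
      ∑ j ∈ range #J, ∑ l ∈ range (#K + 1), norlundMatrix w j l := by
  have hk : k ∉ K := fun h => lt_irrefl _ (hlt k h)
  have hanti := tailRatio_antitone hw0 hw hwa #K
  have hKk : #K ≤ k := by
    simpa using card_le_card (show K ⊆ range k from fun l hl => mem_range.2 (hlt l hl))
  have hrow : ∀ j ∈ J.filter (fun j => ¬ j < k),
      ∑ l ∈ insert k K, norlundMatrix w j l ≤ tailRatio w #K (j - k) := by
    intro j hj
    have hkj : k ≤ j := not_lt.1 (mem_filter.1 hj).2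
    have hle : ∀ l ∈ insert k K, l ≤ k := by
      intro l hl
      rcases mem_insert.1 hl with rfl | hl
      · exact le_rfl
      · exact (hlt l hl).le
    rw [sum_congr rfl fun l hl => norlundMatrix_of_le ((hle l hl).trans hkj), ← sum_div]
    have h := sum_sub_le_sum_range_add_of_antitone hwa k j hkj _ hle
    rw [card_insert_of_notMem hk] at h
    exact div_le_div₀ (sum_nonneg fun i _ => hw _) h (sum_range_succ_pos hw0 hw _)
      (sum_range_mono_of_nonneg hw (by omega))
  have hcard := card_filter_add_card_filter_not (s := J) (fun j => j < k)
  rw [← sum_filter_add_sum_filter_not J (fun j => j < k), ← hcard, sum_range_add]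
  simp only [sum_range_norlundMatrix_eq_tailRatio hw0 hw]
  refine add_le_add ?_ ?_
  · calc ∑ j ∈ J with j < k, ∑ l ∈ insert k K, norlundMatrix w j l
        ≤ ∑ j ∈ J with j < k, 1 := sum_le_sum fun j _ => sum_norlundMatrix_le_one hw0 hw j _
      _ = ∑ j ∈ range #{j ∈ J | j < k}, (1 : ℝ) := by simp
      _ ≤ _ := le_of_eq (sum_congr rfl fun j hj => by
          have hj := mem_range.1 hj
          rw [Nat.sub_eq_zero_of_le (by omega), tailRatio_zero hw0 hw])
  · calc _ ≤ _ := sum_le_sum hrow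
      _ ≤ _ := sum_le_sum_range_add_of_antitone hanti k _
          fun j hj => not_lt.1 (mem_filter.1 hj).2
      _ ≤ _ := sum_le_sum fun i _ => hanti (by omega)

/-- If at least `r` rows of `J` lie above the column `k`, then the sum of column `k` over `J` is
at most the sum of column `r` over the initial segment. -/
lemma sum_col_le (hw0 : 0 < w 0) (hw : ∀ n, 0 ≤ w n) (hwa : Antitone w)
    (J : Finset ℕ) (k r : ℕ) (hm : r ≤ #{j ∈ J | j < k}) :
    ∑ j ∈ J, norlundMatrix w j k ≤ ∑ j ∈ range #J, norlundMatrix w j r := by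
  have hrk : r ≤ k := hm.trans <| by
    simpa using card_le_card (show {j ∈ J | j < k} ⊆ range k from
      fun j hj => mem_range.2 (mem_filter.1 hj).2)
  have hcard := card_filter_add_card_filter_not (s := J) (fun j => j < k)
  have hanti : Antitone fun i => w i / ∑ l ∈ range (r + i + 1), w l := fun a b hab =>
    div_le_div₀ (hw _) (hwa hab) (sum_range_succ_pos hw0 hw _)
      (sum_range_mono_of_nonneg hw (by omega))
  have hlow : ∑ j ∈ J with j < k, norlundMatrix w j k = 0 :=
    sum_eq_zero fun j hj => norlundMatrix_of_lt (mem_filter.1 hj).2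
  have hJ : #J = r + (#J - r) := by omega
  rw [← sum_filter_add_sum_filter_not J (fun j => j < k), hlow, zero_add, hJ, sum_range_add]
  calc ∑ j ∈ J with ¬ j < k, norlundMatrix w j k
      ≤ ∑ j ∈ J with ¬ j < k, w (j - k) / ∑ l ∈ range (r + (j - k) + 1), w l := by
        refine sum_le_sum fun j hj => ?_
        have hkj : k ≤ j := not_lt.1 (mem_filter.1 hj).2
        rw [norlundMatrix_of_le hkj]
        exact div_le_div₀ (hw _) le_rfl (sum_range_succ_pos hw0 hw _)
          (sum_range_mono_of_nonneg hw (by omega))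
    _ ≤ ∑ i ∈ range #{j ∈ J | ¬ j < k}, w i / ∑ l ∈ range (r + i + 1), w l :=
        sum_le_sum_range_add_of_antitone hanti k _ fun j hj => not_lt.1 (mem_filter.1 hj).2
    _ ≤ ∑ i ∈ range (#J - r), w i / ∑ l ∈ range (r + i + 1), w l :=
        sum_le_sum_of_subset_of_nonneg (range_mono (by omega)) fun i _ _ =>
          div_nonneg (hw _) (sum_nonneg fun i _ => hw i)
    _ = ∑ i ∈ range (#J - r), norlundMatrix w (r + i) r := sum_congr rfl fun i _ => by
        rw [norlundMatrix_of_le (by omega), Nat.add_sub_cancel_left]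
    _ ≤ _ := le_add_of_nonneg_left (sum_nonneg fun j _ => norlundMatrix_nonneg hw j r)

theorem sum_norlundMatrix_le_sum_range (hw0 : 0 < w 0) (hw : ∀ n, 0 ≤ w n) (hwa : Antitone w)
    (J K : Finset ℕ) :
    ∑ j ∈ J, ∑ k ∈ K, norlundMatrix w j k ≤
      ∑ j ∈ range #J, ∑ k ∈ range #K, norlundMatrix w j k := by
  induction K using Finset.induction_on_max with
  | empty => simp
  | insert k K hlt ih =>
    have hk : k ∉ K := fun h => lt_irrefl _ (hlt k h)
    rw [card_insert_of_notMem hk]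
    rcases le_total #{j ∈ J | j < k} #K with hm | hm
    · exact sum_rows_le hw0 hw hwa J K k hlt hm
    · simp only [sum_insert hk, sum_range_succ _ #K, sum_add_distrib]
      rw [add_comm]
      exact add_le_add ih (sum_col_le hw0 hw hwa J k #K hm)

end Norlund

/-! ### Decreasing rearrangements -/

/-- `y` is the decreasing rearrangement of `x`: for `t ≥ 0`, `y n` exceeds `t` iff at least
`n + 1` entries of `x` do. -/
def IsDecrRearrangement (x y : ℕ → ℝ) : Prop :=
  ∀ t : ℝ, 0 ≤ t → ∀ n, t < y n ↔ ∃ S : Finset ℕ, #S = n + 1 ∧ ∀ k ∈ S, t < x k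

lemma exists_isDecrRearrangement {x : ℕ → ℝ} (hx : ∀ k, 0 ≤ x k) (hb : BddAbove (Set.range x)) :
    ∃ y : ℕ → ℝ, (∀ n, 0 ≤ y n) ∧ Antitone y ∧ IsDecrRearrangement x y := by
  obtain ⟨M, hM⟩ := hb
  set A : ℕ → Set ℝ := fun n => {s | ∃ S : Finset ℕ, #S = n + 1 ∧ ∀ k ∈ S, s ≤ x k} with hA
  have hne : ∀ n, (0 : ℝ) ∈ A n := fun n => ⟨range (n + 1), by simp, fun k _ => hx k⟩
  have hbd : ∀ n, BddAbove (A n) := by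
    refine fun n => ⟨M, ?_⟩
    rintro s ⟨S, hS, hs⟩
    obtain ⟨k, hk⟩ : S.Nonempty := card_pos.1 (by omega)
    exact (hs k hk).trans (hM ⟨k, rfl⟩)
  refine ⟨fun n => sSup (A n), fun n => le_csSup (hbd n) (hne n), fun m n hmn => ?_, ?_⟩
  · refine csSup_le_csSup (hbd m) ⟨0, hne n⟩ ?_
    rintro s ⟨S, hS, hs⟩
    obtain ⟨T, hT, hTc⟩ := exists_subset_card_eq (show m + 1 ≤ #S by omega)
    exact ⟨T, hTc, fun k hk => hs k (hT hk)⟩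
  · intro t _ n
    rw [lt_csSup_iff (hbd n) ⟨0, hne n⟩]
    constructor
    · rintro ⟨s, ⟨S, hS, hs⟩, hts⟩
      exact ⟨S, hS, fun k hk => hts.trans_le (hs k hk)⟩
    · rintro ⟨S, hS, hs⟩
      have hSne : S.Nonempty := card_pos.1 (by omega)
      exact ⟨S.inf' hSne x, ⟨S, hS, fun k hk => inf'_le x hk⟩, (lt_inf'_iff hSne).2 hs⟩

lemma IsDecrRearrangement.rpow {x y : ℕ → ℝ} (h : IsDecrRearrangement x y)
    (hx : ∀ k, 0 ≤ x k) (hy : ∀ k, 0 ≤ y k) {q : ℝ} (hq : 0 < q) :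
    IsDecrRearrangement (fun k => x k ^ q) (fun k => y k ^ q) := by
  intro t ht n
  have key : ∀ z : ℝ, 0 ≤ z → (t < z ^ q ↔ t ^ q⁻¹ < z) := fun z hz =>
    (Real.rpow_inv_lt_iff_of_pos ht hz hq).symm
  simp only [key _ (hy _), key _ (hx _)]
  exact h _ (Real.rpow_nonneg ht _) n

lemma tsum_ofReal_mul_eq_lintegral (x : ℕ → ℝ) (b : ℕ → ℝ≥0∞) :
    ∑' k, ENNReal.ofReal (x k) * b k =
      ∫⁻ t in Set.Ioi (0 : ℝ), ∑' k, (Set.Iio (x k)).indicator (fun _ => b k) t := by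
  rw [lintegral_tsum fun k => (measurable_const.indicator measurableSet_Iio).aemeasurable]
  refine tsum_congr fun k => ?_
  rw [lintegral_indicator_const measurableSet_Iio, Measure.restrict_apply measurableSet_Iio,
    Set.Iio_inter_Ioi, Real.volume_Ioo, sub_zero, mul_comm]

lemma IsDecrRearrangement.tsum_mul_le {x y : ℕ → ℝ} (h : IsDecrRearrangement x y)
    {b b' : ℕ → ℝ≥0∞} (hb : ∀ K : Finset ℕ, ∑ k ∈ K, b k ≤ ∑ k ∈ range #K, b' k) :
    ∑' k, ENNReal.ofReal (x k) * b k ≤ ∑' k, ENNReal.ofReal (y k) * b' k := by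
  rw [tsum_ofReal_mul_eq_lintegral, tsum_ofReal_mul_eq_lintegral]
  refine setLIntegral_mono' measurableSet_Ioi fun t ht => ?_
  rw [ENNReal.tsum_eq_iSup_sum]
  refine iSup_le fun K => ?_
  simp only [Set.indicator_apply, Set.mem_Iio]
  rw [← sum_filter]
  refine (hb _).trans (le_trans ?_ (ENNReal.sum_le_tsum (range #{k ∈ K | t < x k})))
  refine sum_le_sum fun n hn => ?_
  rw [if_pos]
  obtain ⟨T, hT, hTc⟩ := exists_subset_card_eq (Nat.succ_le_of_lt (mem_range.1 hn))
  exact (h t (le_of_lt ht) n).2 ⟨T, hTc, fun k hk => (mem_filter.1 (hT hk)).2⟩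

lemma IsDecrRearrangement.tsum_eq {x y : ℕ → ℝ} (h : IsDecrRearrangement x y) :
    ∑' k, ENNReal.ofReal (y k) = ∑' k, ENNReal.ofReal (x k) := by
  refine le_antisymm ?_ ?_
  · have hx := tsum_ofReal_mul_eq_lintegral x fun _ => 1
    have hy := tsum_ofReal_mul_eq_lintegral y fun _ => 1
    simp only [mul_one] at hx hy
    rw [hx, hy]
    refine setLIntegral_mono' measurableSet_Ioi fun t ht => ?_
    rw [ENNReal.tsum_eq_iSup_sum]
    refine iSup_le fun K => ?_
    simp only [Set.indicator_apply, Set.mem_Iio]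
    rw [← sum_filter]
    rcases (K.filter fun n => t < y n).eq_empty_or_nonempty with he | hne
    · simp [he]
    · set N := (K.filter fun n => t < y n).max' hne
      obtain ⟨S, hS, hSx⟩ := (h t (le_of_lt ht) N).1 (mem_filter.1 (max'_mem _ hne)).2
      have hcard : #{n ∈ K | t < y n} ≤ #S := by
        rw [hS, ← card_range (N + 1)]
        exact card_le_card fun n hn => mem_range.2 (Nat.lt_succ_of_le (le_max' _ n hn))
      refine le_trans ?_ (ENNReal.sum_le_tsum S)
      rw [sum_congr rfl fun k hk => if_pos (hSx k hk)]
      simpa using hcard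
  · simpa using h.tsum_mul_le (b := fun _ => 1) (b' := fun _ => 1) fun K => by simp

lemma IsDecrRearrangement.tsum_rpow_eq {x y : ℕ → ℝ} (h : IsDecrRearrangement x y)
    (hx : ∀ k, 0 ≤ x k) (hy : ∀ k, 0 ≤ y k) {q : ℝ} (hq : 0 < q) :
    ∑' k, ENNReal.ofReal (y k) ^ q = ∑' k, ENNReal.ofReal (x k) ^ q := by
  simpa only [ENNReal.ofReal_rpow_of_nonneg (hx _) hq.le,
    ENNReal.ofReal_rpow_of_nonneg (hy _) hq.le] using (h.rpow hx hy hq).tsum_eq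

/-! ### Majorization and `ℓ_p`-sums -/

lemma sum_rpow_le_tsum_rpow_of_majorized {p : ℝ} (hp : 1 < p) {u v : ℕ → ℝ≥0∞}
    (hv : ∀ i, v i ≠ ⊤)
    (huv : ∀ J : Finset ℕ, ∑ j ∈ J, u j ≤ ∑ j ∈ range #J, v j) (J : Finset ℕ) :
    ∑ j ∈ J, u j ^ p ≤ ∑' j, v j ^ p := by
  have hu : ∀ j, u j ≠ ⊤ := fun j => ne_top_of_le_ne_top (hv 0) (by simpa using huv {j})
  have hpq := Real.HolderConjugate.conjExponent hp
  set q := p.conjExponent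
  have hp0 : 0 < p := hpq.pos
  have hq0 : 0 < q := hpq.symm.pos
  set c : ℕ → ℝ := fun j => if j ∈ J then (u j).toReal ^ (p - 1) else 0 with hc
  have hc0 : ∀ j, 0 ≤ c j := fun j => by
    simp only [hc]
    split_ifs
    · positivity
    · exact le_rfl
  have hofReal : ∀ j ∈ J, ENNReal.ofReal (c j) = u j ^ (p - 1) := fun j hj => by
    simp only [hc, if_pos hj]
    rw [← ENNReal.ofReal_rpow_of_nonneg ENNReal.toReal_nonneg (by linarith),
      ENNReal.ofReal_toReal (hu j)]
  have hofReal0 : ∀ j ∉ J, ENNReal.ofReal (c j) = 0 := fun j hj => by simp [hc, hj]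
  have hbdd : BddAbove (Set.range c) := by
    refine ⟨∑ j ∈ J, c j, ?_⟩
    rintro _ ⟨j, rfl⟩
    by_cases hj : j ∈ J
    · exact single_le_sum (f := c) (fun i _ => hc0 i) hj
    · simp only [hc, if_neg hj]
      exact sum_nonneg fun i _ => hc0 i
  obtain ⟨d, hd0, -, hd⟩ := exists_isDecrRearrangement hc0 hbdd
  have h1 : ∑' j, ENNReal.ofReal (c j) * u j = ∑ j ∈ J, u j ^ p := by
    rw [tsum_eq_sum (s := J) fun j hj => by rw [hofReal0 j hj, zero_mul]]
    refine sum_congr rfl fun j hj => ?_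
    rw [hofReal j hj]
    nth_rewrite 2 [← ENNReal.rpow_one (u j)]
    rw [← ENNReal.rpow_add_of_nonneg _ _ (by linarith) zero_le_one, sub_add_cancel]
  have h2 : ∑' j, ENNReal.ofReal (d j) ^ q = ∑ j ∈ J, u j ^ p := by
    rw [hd.tsum_rpow_eq hc0 hd0 hq0,
      tsum_eq_sum (s := J) fun j hj => by rw [hofReal0 j hj, ENNReal.zero_rpow_of_pos hq0]]
    refine sum_congr rfl fun j hj => ?_
    rw [hofReal j hj, ← ENNReal.rpow_mul, hpq.sub_one_mul_conj]
  have hT : ∑ j ∈ J, u j ^ p ≠ ⊤ :=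
    (ENNReal.sum_lt_top.2 fun j _ => ENNReal.rpow_lt_top_of_nonneg hp0.le (hu j)).ne
  have h3 := hd.tsum_mul_le huv
  rw [h1] at h3
  have h4 : ∑' j, ENNReal.ofReal (d j) * v j ≤
      (∑' j, v j ^ p) / ENNReal.ofReal p + (∑ j ∈ J, u j ^ p) / ENNReal.ofReal q := by
    rw [← h2]
    simp only [div_eq_mul_inv]
    rw [← ENNReal.tsum_mul_right, ← ENNReal.tsum_mul_right, ← ENNReal.tsum_add]
    refine ENNReal.tsum_le_tsum fun j => ?_
    rw [mul_comm]
    simpa only [div_eq_mul_inv] using ENNReal.young_inequality (v j) (ENNReal.ofReal (d j)) hpq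
  have h5 : ∑ j ∈ J, u j ^ p = (∑ j ∈ J, u j ^ p) / ENNReal.ofReal p +
      (∑ j ∈ J, u j ^ p) / ENNReal.ofReal q := by
    rw [div_eq_mul_inv, div_eq_mul_inv, ← mul_add, hpq.inv_add_inv_ennreal, mul_one]
  have h6 := ENNReal.le_of_add_le_add_right
    (ENNReal.div_ne_top hT (ENNReal.ofReal_pos.2 hq0).ne') (h5.symm.trans_le (h3.trans h4))
  rwa [ENNReal.div_le_iff (ENNReal.ofReal_pos.2 hp0).ne' ENNReal.ofReal_ne_top,
    ENNReal.div_mul_cancel (ENNReal.ofReal_pos.2 hp0).ne' ENNReal.ofReal_ne_top] at h6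

lemma tsum_rpow_le_of_majorized {p : ℝ} (hp : 1 ≤ p) {u v : ℕ → ℝ≥0∞}
    (huv : ∀ J : Finset ℕ, ∑ j ∈ J, u j ≤ ∑ j ∈ range #J, v j) :
    ∑' j, u j ^ p ≤ ∑' j, v j ^ p := by
  rw [ENNReal.tsum_eq_iSup_sum]
  refine iSup_le fun J => ?_
  rcases hp.eq_or_lt with rfl | hp
  · simpa only [ENNReal.rpow_one] using (huv J).trans (ENNReal.sum_le_tsum _)
  · by_cases hv : ∀ i, v i ≠ ⊤
    · exact sum_rpow_le_tsum_rpow_of_majorized hp hv huv J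
    · push Not at hv
      obtain ⟨i, hi⟩ := hv
      rw [ENNReal.tsum_eq_top_of_eq_top
        ⟨i, by rw [hi, ENNReal.top_rpow_of_pos (by linarith)]⟩]
      exact le_top

theorem detByDecr_of_sum_le_sum_range {p : ℝ} (hp : 1 ≤ p) {A : ℕ → ℕ → ℝ}
    (hA0 : ∀ j k, 0 ≤ A j k)
    (hA : ∀ J K : Finset ℕ,
      ∑ j ∈ J, ∑ k ∈ K, A j k ≤ ∑ j ∈ range #J, ∑ k ∈ range #K, A j k) :
    DetByDecr p A := by
  intro x hx hxp
  have hp0 : 0 < p := by linarith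
  have hb : BddAbove (Set.range x) := by
    refine ⟨((∑' k, ENNReal.ofReal (x k) ^ p) ^ p⁻¹).toReal, ?_⟩
    rintro _ ⟨k, rfl⟩
    rw [← ENNReal.ofReal_le_iff_le_toReal
      (ENNReal.rpow_lt_top_of_nonneg (inv_nonneg.2 hp0.le) hxp.ne).ne,
      ENNReal.le_rpow_inv_iff hp0]
    exact ENNReal.le_tsum k
  obtain ⟨y, hy0, hya, hxy⟩ := exists_isDecrRearrangement hx hb
  refine ⟨y, hy0, hya, hxy.tsum_rpow_eq hx hy0 hp0, tsum_rpow_le_of_majorized hp fun J => ?_⟩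
  have hsum : ∀ (z : ℕ → ℝ) (L : Finset ℕ), ∑ j ∈ L, mulVec A z j =
      ∑' k, ENNReal.ofReal (z k) * ENNReal.ofReal (∑ j ∈ L, A j k) := by
    intro z L
    simp only [mulVec]
    rw [← Summable.tsum_finsetSum fun _ _ => ENNReal.summable]
    refine tsum_congr fun k => ?_
    rw [ENNReal.ofReal_sum_of_nonneg fun j _ => hA0 j k, mul_sum]
    exact sum_congr rfl fun j _ => by rw [ENNReal.ofReal_mul (hA0 j k), mul_comm]
  rw [hsum, hsum]
  refine hxy.tsum_mul_le fun K => ?_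
  rw [← ENNReal.ofReal_sum_of_nonneg fun k _ => sum_nonneg fun j _ => hA0 j k,
    ← ENNReal.ofReal_sum_of_nonneg fun k _ => sum_nonneg fun j _ => hA0 j k,
    sum_comm, sum_comm (s := range #K)]
  exact ENNReal.ofReal_le_ofReal (hA J K)

/-- Corollary 4.5 for `E = F = ℓ_p`: if `w` is nonnegative, decreasing, with `w_1 > 0`,
then the `ℓ_p`-norm of the Nörlund mean matrix `A_W^{NM}` is determined by decreasing
sequences, and the same holds for its transpose `(A_W^{NM})ᵗ`. -/
theorem lp_norm_determined_by_decreasing_norlund_of_antitone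
    (p : ℝ) (hp : 1 ≤ p)
    (w : ℕ → ℝ) (hw0 : 0 < w 0) (hw : ∀ n, 0 ≤ w n) (hwa : Antitone w) :
    DetByDecr p (norlundMatrix w) ∧
      DetByDecr p (fun j k => norlundMatrix w k j) := by
  refine ⟨detByDecr_of_sum_le_sum_range hp (norlundMatrix_nonneg hw)
    (sum_norlundMatrix_le_sum_range hw0 hw hwa),
    detByDecr_of_sum_le_sum_range hp (fun j k => norlundMatrix_nonneg hw k j) fun J K => ?_⟩
  rw [sum_comm, sum_comm (s := range #J)]
  exact sum_norlundMatrix_le_sum_range hw0 hw hwa K J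
end
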